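/- Let F be a field of characteristic 2 and let ψ₁,…,ψ_t be quadratic Pfister forms over F that are separably k-linked. If ψ₁,…,ψ_t are also inseparably k-linked (they share a common k-fold bilinear Pfister factor), then their k-invariant F_k(ψ₁,…,ψ_t) is hyperbolic. -/

import Mathlib

noncomputable section

open QuadraticMap

/-- A quadratic form over `F` on the space `F^d`, bundled together with its dimension `d`. -/
structure QF (F : Type) [Field F] where
  dim : ℕ
  form : QuadraticForm F (Fin dim → F)

namespace QF

variable {F : Type} [Field F]

/-- Isometry of bundled quadratic forms. -/
def Equiv (q q' : QF F) : Prop := QuadraticMap.Equivalent q.form q'.form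

/-- The standard linear equivalence `F^(a+b) ≃ F^a × F^b`. -/
def finSplit (F : Type) [Field F] (a b : ℕ) :
    (Fin (a + b) → F) ≃ₗ[F] (Fin a → F) × (Fin b → F) :=
  (LinearEquiv.funCongrLeft F F finSumFinEquiv).trans
    (LinearEquiv.sumArrowLequivProdArrow _ _ F F)

/-- Orthogonal sum of bundled quadratic forms. -/
def sum (q₁ q₂ : QF F) : QF F :=
  ⟨q₁.dim + q₂.dim, (q₁.form.prod q₂.form).comp (finSplit F q₁.dim q₂.dim).toLinearMap⟩

instance : Neg (QF F) := ⟨fun q => ⟨q.dim, -q.form⟩⟩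

instance : SMul F (QF F) := ⟨fun a q => ⟨q.dim, a • q.form⟩⟩

/-- `⟨⟨γ⟩⟩ ⊗ q = q ⊥ (−γ)·q` : twisting a quadratic form by the
1-fold bilinear Pfister form `⟨⟨γ⟩⟩ = ⟨1, −γ⟩`. -/
def twist (γ : F) (q : QF F) : QF F := q.sum ((-γ) • q)

/-- `⟨⟨γ₁,…,γ_m⟩⟩ ⊗ q` : tensoring a quadratic form with the `m`-fold bilinear
Pfister form whose slots are the entries of the list `l = [γ₁,…,γ_m]`. -/
def btensor (l : List F) (q : QF F) : QF F := l.foldr twist q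

/-- The zero form on the zero space. -/
def zero (F : Type) [Field F] : QF F := ⟨0, 0⟩

/-- The one-dimensional form `⟨1⟩`, `x ↦ x²`. -/
def unit (F : Type) [Field F] : QF F := ⟨1, QuadraticMap.sq.comp (LinearMap.proj 0)⟩

/-- The binary quadratic form `[1,α] : (x,y) ↦ x² + xy + αy²`. -/
def binary (α : F) : QF F := ⟨2, (Matrix.of ![![1, 1], ![0, α]]).toQuadraticMap'⟩

/-- The hyperbolic plane `ℍ : (x,y) ↦ xy`. -/
def hyp (F : Type) [Field F] : QF F := ⟨2, (Matrix.of ![![0, 1], ![0, 0]]).toQuadraticMap'⟩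

/-- `m × ℍ`, the orthogonal sum of `m` hyperbolic planes. -/
def hyps (F : Type) [Field F] : ℕ → QF F
  | 0 => zero F
  | n + 1 => (hyp F).sum (hyps F n)

/-- A quadratic form is isotropic if it represents `0` nontrivially. -/
def Isotropic (q : QF F) : Prop := ∃ v, q.form v = 0 ∧ v ≠ 0

/-- A quadratic form is hyperbolic if it is isometric to an orthogonal
sum of hyperbolic planes. -/
def Hyperbolic (q : QF F) : Prop := ∃ m, q.Equiv (hyps F m)

/-- All entries of the list are nonzero (the slots of a bilinear Pfister form
must be units). -/
def UnitList (l : List F) : Prop := ∀ γ ∈ l, γ ≠ 0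

/-- `q` is an `n`-fold quadratic Pfister form.  In characteristic `2` this means
`q ≅ ⟨⟨γ₁,…,γ_{n−1}, α]] = ⟨⟨γ₁,…,γ_{n−1}⟩⟩ ⊗ [1,α]`; in characteristic `≠ 2` it means
`q ≅ ⟨⟨γ₁,…,γ_n⟩⟩ = ⟨1,−γ₁⟩ ⊗ ⋯ ⊗ ⟨1,−γ_n⟩`. -/
def IsQPfister (n : ℕ) (q : QF F) : Prop :=
  if ringChar F = 2 then
    ∃ (l : List F) (α : F), UnitList l ∧ l.length + 1 = n ∧ (btensor l (binary α)).Equiv q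
  else
    ∃ l : List F, UnitList l ∧ l.length = n ∧ (btensor l (unit F)).Equiv q

/-- `φ` is a `k`-fold quadratic Pfister factor of `ψ`, i.e. `ψ ≅ B ⊗ φ` for some
bilinear Pfister form `B`. -/
def IsQPfisterFactor (k : ℕ) (φ ψ : QF F) : Prop :=
  IsQPfister k φ ∧ ∃ l : List F, UnitList l ∧ (btensor l φ).Equiv ψ

/-- A finite family of quadratic Pfister forms is (separably) `k`-linked if its members
share a common `k`-fold quadratic Pfister factor. -/
def SepLinked (k : ℕ) (ψs : List (QF F)) : Prop :=
  ∃ π : QF F, IsQPfister k π ∧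
    ∀ ψ ∈ ψs, ∃ l : List F, UnitList l ∧ (btensor l π).Equiv ψ

/-- A finite family of quadratic Pfister forms is inseparably `k`-linked if its members
share a common `k`-fold bilinear Pfister factor. -/
def InsepLinked (k : ℕ) (ψs : List (QF F)) : Prop :=
  ∃ l : List F, UnitList l ∧ l.length = k ∧
    ∀ ψ ∈ ψs, ∃ (n : ℕ) (π : QF F), IsQPfister n π ∧ (btensor l π).Equiv ψ

/-- `q` is the value of the two-form invariant `F²_k(ψ₁, ψ₂) = φ₁ ⊗ φ₂ ⊗ π`
for some presentation `ψ₁ ≅ φ₁ ⊗ π`, `ψ₂ ≅ φ₂ ⊗ π`. -/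
def IsPairInv (k : ℕ) (ψ₁ ψ₂ q : QF F) : Prop :=
  ∃ (π : QF F) (l₁ l₂ : List F), IsQPfister k π ∧ UnitList l₁ ∧ UnitList l₂ ∧
    (btensor l₁ π).Equiv ψ₁ ∧ (btensor l₂ π).Equiv ψ₂ ∧
    q.Equiv (btensor l₁ (btensor l₂ π))

/-- `IsInv k ψs q` : `q` is a value of the inductively defined invariant
`F^m_k(ψ₁,…,ψ_m)`, where `F¹_k(ψ) = ψ` and
`F^m_k(ψ₁,…,ψ_m) = F²_k(F^{m−1}_k(ψ₁,…,ψ_{m−1}), ψ_m)`. -/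
inductive IsInv (k : ℕ) : List (QF F) → QF F → Prop
  | single (ψ : QF F) : IsInv k [ψ] ψ
  | step {ψs : List (QF F)} {ψ q' q : QF F} :
      IsInv k ψs q' → IsPairInv k q' ψ q → IsInv k (ψs ++ [ψ]) q

end QF
namespace QF

variable {F : Type} [Field F]

/-- The (upper triangular) Gram-type matrix of a bundled quadratic form:
`q(∑ xᵢ eᵢ) = ∑ᵢ q(eᵢ) xᵢ² + ∑_{i<j} polar(eᵢ,eⱼ) xᵢ xⱼ`. -/
def matrixOf (q : QF F) : Matrix (Fin q.dim) (Fin q.dim) F := fun i j =>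
  if i = j then q.form (Pi.single i 1)
  else if i < j then polar q.form (Pi.single i 1) (Pi.single j 1)
  else 0

/-- Base change (extension of scalars) of a bundled quadratic form along a
ring homomorphism of fields. -/
def baseChange {E : Type} [Field E] (σ : F →+* E) (q : QF F) : QF E :=
  ⟨q.dim, (q.matrixOf.map σ).toQuadraticMap'⟩

/-- The homogeneous degree-2 polynomial cut out by a bundled quadratic form. -/
def toPoly (q : QF F) : MvPolynomial (Fin q.dim) F :=
  ∑ i, ∑ j, MvPolynomial.C (q.matrixOf i j) * (MvPolynomial.X i * MvPolynomial.X j)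

/-- The affine coordinate ring of the quadric `q = 0`. -/
def coordRing (q : QF F) : Type :=
  MvPolynomial (Fin q.dim) F ⧸ Ideal.span {q.toPoly}

instance (q : QF F) : CommRing q.coordRing := Ideal.Quotient.commRing _
instance (q : QF F) : Algebra F q.coordRing := Ideal.Quotient.algebra F

/-- The function field `F(q)` of the quadric `q = 0` (assuming the coordinate
ring is a domain). -/
def funField (q : QF F) : Type := FractionRing q.coordRing

instance (q : QF F) : CommRing q.funField := by unfold funField; infer_instance

noncomputable instance (q : QF F) [IsDomain q.coordRing] : Field q.funField := by
  unfold funField; infer_instance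

/-- The canonical embedding `F → F(q)`. -/
noncomputable def toFunField (q : QF F) : F →+* q.funField :=
  (algebraMap q.coordRing (FractionRing q.coordRing)).comp (algebraMap F q.coordRing)

/-- `⟨⟨γ₁,…,γ_m⟩⟩′ ⊗ q` : the tensor product with `q` of the pure part of the
bilinear Pfister form with slots `γ₁,…,γ_m`, so that
`⟨⟨l⟩⟩ ⊗ q ≅ q ⊥ (⟨⟨l⟩⟩′ ⊗ q)`. -/
def bpure : List F → QF F → QF F
  | [], _ => zero F
  | γ :: l, q => (bpure l q).sum ((-γ) • btensor l q)

end QF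
namespace QF

variable {F : Type} [Field F]

theorem Equiv.refl (q : QF F) : q.Equiv q := QuadraticMap.Equivalent.refl _

theorem Equiv.symm {q r : QF F} (h : q.Equiv r) : r.Equiv q := QuadraticMap.Equivalent.symm h

theorem Equiv.trans {q r s : QF F} (h : q.Equiv r) (h' : r.Equiv s) : q.Equiv s :=
  QuadraticMap.Equivalent.trans h h'

theorem sum_equivalent_prod (q r : QF F) :
    (q.sum r).form.Equivalent (q.form.prod r.form) :=
  ⟨{ finSplit F q.dim r.dim with map_app' := fun _ => rfl }⟩

theorem Equiv.sum {q q' r r' : QF F} (h : q.Equiv q') (h' : r.Equiv r') :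
    (q.sum r).Equiv (q'.sum r') := by
  obtain ⟨e⟩ := h
  obtain ⟨e'⟩ := h'
  exact (sum_equivalent_prod q r).trans
    (QuadraticMap.Equivalent.trans ⟨e.prod e'⟩ (sum_equivalent_prod q' r').symm)

theorem sum_comm (q r : QF F) : (q.sum r).Equiv (r.sum q) :=
  (sum_equivalent_prod q r).trans
    (QuadraticMap.Equivalent.trans ⟨IsometryEquiv.prodComm _ _⟩ (sum_equivalent_prod r q).symm)

theorem equivalent_of_inverse {V W : Type*} [AddCommGroup V] [Module F V] [AddCommGroup W]
    [Module F W] {Q : QuadraticForm F V} {R : QuadraticForm F W} (f : V → W) (g : W → V)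
    (h_add : ∀ x y, f (x + y) = f x + f y) (h_smul : ∀ (c : F) x, f (c • x) = c • f x)
    (h_left : ∀ x, g (f x) = x) (h_right : ∀ y, f (g y) = y) (h_map : ∀ x, R (f x) = Q x) :
    Q.Equivalent R :=
  ⟨{ toFun := f, invFun := g, map_add' := h_add, map_smul' := h_smul, left_inv := h_left,
     right_inv := h_right, map_app' := h_map }⟩

theorem equivalent_fin_two {Q R : QuadraticForm F (Fin 2 → F)} (a b c d : F)
    (hdet : a * d - b * c ≠ 0)
    (h : ∀ v : Fin 2 → F, R ![a * v 0 + b * v 1, c * v 0 + d * v 1] = Q v) : Q.Equivalent R := by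
  obtain ⟨k, hk⟩ := (IsUnit.mk0 _ hdet).exists_right_inv
  refine equivalent_of_inverse (fun v => ![a * v 0 + b * v 1, c * v 0 + d * v 1])
    (fun v => ![k * (d * v 0 - b * v 1), k * (a * v 1 - c * v 0)])
    (fun x y => ?_) (fun c x => ?_) (fun x => ?_) (fun x => ?_) h
  · funext i; fin_cases i <;> simp <;> ring
  · funext i; fin_cases i <;> simp <;> ring
  · funext i
    fin_cases i <;> simp only [Fin.zero_eta, Fin.mk_one, Matrix.cons_val_zero, Matrix.cons_val_one]
    · linear_combination x 0 * hk
    · linear_combination x 1 * hk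
  · funext i
    fin_cases i <;> simp only [Fin.zero_eta, Fin.mk_one, Matrix.cons_val_zero, Matrix.cons_val_one]
    · linear_combination x 0 * hk
    · linear_combination x 1 * hk

theorem sum_assoc (q r s : QF F) : ((q.sum r).sum s).Equiv (q.sum (r.sum s)) := by
  obtain ⟨e⟩ := sum_equivalent_prod q r
  obtain ⟨e'⟩ := sum_equivalent_prod r s
  have h : ((q.form.prod r.form).prod s.form).Equivalent (q.form.prod (r.form.prod s.form)) :=
    equivalent_of_inverse (fun x => (x.1.1, x.1.2, x.2)) (fun x => ((x.1, x.2.1), x.2.2))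
      (fun _ _ => rfl) (fun _ _ => rfl) (fun _ => rfl) (fun _ => rfl)
      (fun _ => (add_assoc _ _ _).symm)
  exact ((sum_equivalent_prod _ _).trans ⟨e.prod (QuadraticMap.IsometryEquiv.refl _)⟩).trans
    (h.trans (QuadraticMap.Equivalent.trans
      ⟨(QuadraticMap.IsometryEquiv.refl _).prod e'.symm⟩ (sum_equivalent_prod _ _).symm))

theorem sum_sum_sum_comm (q r s t : QF F) :
    ((q.sum r).sum (s.sum t)).Equiv ((q.sum s).sum (r.sum t)) := by
  refine (sum_assoc _ _ _).trans (((Equiv.refl q).sum ?_).trans (sum_assoc _ _ _).symm)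
  exact (sum_assoc _ _ _).symm.trans (((sum_comm r s).sum (Equiv.refl t)).trans (sum_assoc _ _ _))

theorem Equiv.smul {q r : QF F} (a : F) (h : q.Equiv r) : (a • q).Equiv (a • r) := by
  obtain ⟨e⟩ := h
  exact ⟨{ e.toLinearEquiv with
    map_app' := fun m => congrArg (a * ·) (e.map_app m) }⟩

theorem smul_smul_eq (a b : F) (q : QF F) : a • b • q = (a * b) • q :=
  congrArg (QF.mk q.dim) (smul_smul a b q.form)

theorem one_smul_eq (q : QF F) : (1 : F) • q = q :=
  congrArg (QF.mk q.dim) (one_smul F q.form)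

theorem smul_sum_eq (a : F) (q r : QF F) : a • q.sum r = (a • q).sum (a • r) :=
  congrArg (QF.mk (q.dim + r.dim)) (QuadraticMap.ext fun _ => mul_add _ _ _)

theorem sq_smul_equiv {a : F} (ha : a ≠ 0) (q : QF F) : ((a * a) • q).Equiv q :=
  ⟨{ LinearEquiv.smulOfNeZero F (Fin q.dim → F) a ha with
    map_app' := fun m => QuadraticMap.map_smul q.form a m }⟩

theorem Equiv.twist {q r : QF F} (γ : F) (h : q.Equiv r) : (q.twist γ).Equiv (r.twist γ) :=
  h.sum (h.smul _)

theorem Equiv.btensor {q r : QF F} (h : q.Equiv r) (l : List F) :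
    (q.btensor l).Equiv (r.btensor l) := by
  induction l with
  | nil => exact h
  | cons γ l ih => exact ih.twist γ

theorem twist_twist_comm (γ δ : F) (q : QF F) :
    ((q.twist δ).twist γ).Equiv ((q.twist γ).twist δ) := by
  unfold QF.twist
  rw [smul_sum_eq, smul_sum_eq, smul_smul_eq, smul_smul_eq, mul_comm (-δ)]
  exact sum_sum_sum_comm _ _ _ _

theorem btensor_twist_comm (l : List F) (γ : F) (q : QF F) :
    (btensor l (q.twist γ)).Equiv ((btensor l q).twist γ) := by
  induction l with
  | nil => exact Equiv.refl _
  | cons δ l ih => exact (ih.twist δ).trans (twist_twist_comm _ _ _)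

theorem btensor_btensor_comm (l l' : List F) (q : QF F) :
    (btensor l (btensor l' q)).Equiv (btensor l' (btensor l q)) := by
  induction l with
  | nil => exact Equiv.refl _
  | cons δ l ih => exact (ih.twist δ).trans (btensor_twist_comm _ _ _).symm

theorem btensor_append (l l' : List F) (q : QF F) :
    btensor (l ++ l') q = btensor l (btensor l' q) := by
  simp [btensor]

theorem hyp_form (v : Fin 2 → F) : (hyp F).form v = v 0 * v 1 := by
  change Matrix.toLinearMap₂' F _ v v = _
  simp [Matrix.toLinearMap₂'_apply, Fin.sum_univ_two]

theorem binary_form (α : F) (v : Fin 2 → F) :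
    (binary α).form v = v 0 * v 0 + v 0 * v 1 + α * (v 1 * v 1) := by
  change Matrix.toLinearMap₂' F _ v v = _
  simp [Matrix.toLinearMap₂'_apply, Fin.sum_univ_two]
  ring

theorem sum_form_symm (q r : QF F) (x : Fin q.dim → F) (y : Fin r.dim → F) :
    (q.sum r).form ((finSplit F q.dim r.dim).symm (x, y)) = q.form x + r.form y := by
  change (q.form.prod r.form) (finSplit F q.dim r.dim ((finSplit F q.dim r.dim).symm (x, y))) = _
  simp

theorem zero_sum_equiv (q : QF F) : ((zero F).sum q).Equiv q :=
  (sum_equivalent_prod _ _).trans <| equivalent_of_inverse Prod.snd (fun x => (0, x))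
    (fun _ _ => rfl) (fun _ _ => rfl) (fun _ => Prod.ext (funext fun i => i.elim0) rfl)
    (fun _ => rfl) (fun _ => (zero_add _).symm)

theorem hyps_add (m n : ℕ) : ((hyps F m).sum (hyps F n)).Equiv (hyps F (m + n)) := by
  induction m with
  | zero => rw [Nat.zero_add]; exact zero_sum_equiv (hyps F n)
  | succ m ih =>
    rw [Nat.succ_add]
    exact (sum_assoc _ _ _).trans ((Equiv.refl _).sum ih)

theorem Hyperbolic.congr {q r : QF F} (h : q.Equiv r) (hr : r.Hyperbolic) : q.Hyperbolic :=
  hr.imp fun _ => h.trans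

theorem Hyperbolic.sum {q r : QF F} (hq : q.Hyperbolic) (hr : r.Hyperbolic) :
    (q.sum r).Hyperbolic := by
  obtain ⟨m, hm⟩ := hq
  obtain ⟨n, hn⟩ := hr
  exact ⟨m + n, (hm.sum hn).trans (hyps_add m n)⟩

theorem smul_hyp_equiv {a : F} (ha : a ≠ 0) : (a • hyp F).Equiv (hyp F) := by
  refine equivalent_fin_two a 0 0 1 (by simpa using ha) fun v => ?_
  refine (hyp_form _).trans (Eq.trans ?_ (congrArg (a * ·) (hyp_form v)).symm)
  simp [mul_assoc]

theorem smul_hyps_equiv {a : F} (ha : a ≠ 0) (n : ℕ) : (a • hyps F n).Equiv (hyps F n) := by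
  induction n with
  | zero => exact ⟨{ LinearEquiv.refl F _ with map_app' := fun _ => (mul_zero a).symm }⟩
  | succ n ih =>
    rw [hyps, smul_sum_eq]
    exact (smul_hyp_equiv ha).sum ih

theorem Hyperbolic.smul {q : QF F} (hq : q.Hyperbolic) {a : F} (ha : a ≠ 0) :
    (a • q).Hyperbolic :=
  hq.imp fun n h => (h.smul a).trans (smul_hyps_equiv ha n)

theorem Hyperbolic.twist {q : QF F} (hq : q.Hyperbolic) {γ : F} (hγ : γ ≠ 0) :
    (q.twist γ).Hyperbolic :=
  hq.sum (hq.smul (neg_ne_zero.2 hγ))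

theorem Hyperbolic.btensor {q : QF F} (hq : q.Hyperbolic) {l : List F} (hl : UnitList l) :
    (q.btensor l).Hyperbolic := by
  induction l with
  | nil => exact hq
  | cons γ l ih =>
    exact (ih fun x hx => hl x (List.mem_cons_of_mem _ hx)).twist (hl γ List.mem_cons_self)

/-- A form is round if each of its nonzero values is a similarity factor. -/
def Round (q : QF F) : Prop := ∀ v, q.form v ≠ 0 → (q.form v • q).Equiv q

theorem smul_sum_smul_equiv {s u : F} (h : s + u ≠ 0) (q : QF F) :
    ((s • q).sum (u • q)).Equiv (((s + u) • q).sum ((s * u * (s + u)) • q)) := by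
  refine Equiv.symm ((sum_equivalent_prod _ _).trans (QuadraticMap.Equivalent.trans ?_
    (sum_equivalent_prod _ _).symm))
  refine equivalent_of_inverse (fun x => (x.1 + u • x.2, x.1 - s • x.2))
    (fun x => ((s + u)⁻¹ • (s • x.1 + u • x.2), (s + u)⁻¹ • (x.1 - x.2)))
    (fun x y => ?_) (fun c x => ?_) (fun x => ?_) (fun x => ?_) (fun x => ?_)
  · ext i <;> simp <;> ring
  · ext i <;> simp <;> ring
  · ext i <;> simp <;> field_simp <;> ring
  · ext i <;> simp <;> field_simp <;> ring
  · change s * q.form (x.1 + u • x.2) + u * q.form (x.1 - s • x.2) =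
      (s + u) * q.form x.1 + s * u * (s + u) * q.form x.2
    rw [sub_eq_add_neg, ← neg_smul, QuadraticMap.map_add q.form, QuadraticMap.map_add q.form]
    simp only [QuadraticMap.map_smul, QuadraticMap.polar_smul_right, smul_eq_mul]
    ring

theorem Round.twist {q : QF F} (hq : q.Round) {γ : F} (hγ : γ ≠ 0) : (q.twist γ).Round := by
  intro v hv
  obtain ⟨⟨x, y⟩, rfl⟩ := (finSplit F q.dim q.dim).symm.surjective v
  have hval : (q.twist γ).form ((finSplit F q.dim q.dim).symm (x, y)) =
      q.form x + -γ * q.form y := sum_form_symm q ((-γ) • q) x y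
  rw [hval] at hv ⊢
  have hg : -γ ≠ 0 := neg_ne_zero.2 hγ
  unfold QF.twist
  rw [smul_sum_eq, smul_smul_eq]
  generalize -γ = g at hv hg
  by_cases hy : q.form y = 0
  · rw [hy, mul_zero, add_zero] at hv ⊢
    rw [mul_comm, ← smul_smul_eq]
    exact (hq x hv).sum ((hq x hv).smul g)
  by_cases hx : q.form x = 0
  · rw [hx, zero_add, mul_comm g, mul_assoc, ← smul_smul_eq, ← smul_smul_eq]
    refine Equiv.trans (Equiv.sum ?_ ?_) (sum_comm _ _)
    · rw [smul_smul_eq, mul_comm, ← smul_smul_eq]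
      exact (hq y hy).smul g
    · rw [smul_smul_eq, mul_comm, ← smul_smul_eq]
      exact ((hq y hy).smul _).trans (sq_smul_equiv hg q)
  · have h₁ : (q.sum (g • q)).Equiv ((q.form x • q).sum ((g * q.form y) • q)) := by
      rw [← smul_smul_eq]
      exact (hq x hx).symm.sum ((hq y hy).symm.smul g)
    refine (h₁.trans ((smul_sum_smul_equiv hv q).trans ((Equiv.refl _).sum ?_))).symm
    have h₂ : q.form x * (g * q.form y) * (q.form x + g * q.form y) =
        (q.form x + g * q.form y) * g * (q.form x * q.form y) := by ring
    rw [h₂, ← smul_smul_eq _ (q.form x * q.form y), ← smul_smul_eq (q.form x)]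
    exact (((hq y hy).smul _).trans (hq x hx)).smul _

theorem Round.btensor {q : QF F} (hq : q.Round) {l : List F} (hl : UnitList l) :
    (q.btensor l).Round := by
  induction l with
  | nil => exact hq
  | cons γ l ih =>
    exact (ih fun x hx => hl x (List.mem_cons_of_mem _ hx)).twist (hl γ List.mem_cons_self)

theorem binary_round (α : F) : (binary α).Round := by
  intro (v : Fin 2 → F) hv
  rw [binary_form] at hv ⊢
  generalize hc : v 0 * v 0 + v 0 * v 1 + α * (v 1 * v 1) = c at hv
  -- multiplication by `v` in the quadratic algebra with norm form `binary α`
  refine equivalent_fin_two (v 0) (-(α * v 1)) (v 1) (v 0 + v 1) ?_ fun x => ?_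
  · rw [← hc] at hv
    convert hv using 1
    ring
  · refine (binary_form α _).trans (Eq.trans ?_ (congrArg (c * ·) (binary_form α x)).symm)
    simp only [← hc, Matrix.cons_val_zero, Matrix.cons_val_one]
    ring

theorem hyp_hyperbolic : (hyp F).Hyperbolic :=
  ⟨1, ((sum_comm _ _).trans (zero_sum_equiv _)).symm⟩

theorem binary_hyperbolic_of_isotropic [CharP F 2] {α : F} (h : (binary α).Isotropic) :
    (binary α).Hyperbolic := by
  obtain ⟨v, hv, hv0⟩ := h
  change Fin 2 → F at v
  rw [binary_form] at hv
  have h1 : v 1 ≠ 0 := by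
    intro h1
    have h0 : v 0 = 0 := by simpa [h1] using hv
    exact hv0 (funext (Fin.forall_fin_two.2 ⟨h0, h1⟩))
  have h2 := CharTwo.two_eq_zero (R := F)
  obtain ⟨t, ht⟩ : ∃ t, t * v 1 = v 0 := ⟨v 0 / v 1, div_mul_cancel₀ _ h1⟩
  have hα : α = t * t + t := by
    rw [← CharTwo.add_eq_zero]
    refine (mul_eq_zero.1 ?_).resolve_right (mul_ne_zero h1 h1)
    rw [← ht] at hv
    linear_combination hv
  refine Hyperbolic.congr ?_ hyp_hyperbolic
  refine equivalent_fin_two 1 t 1 (t + 1) (by simp) fun x => ?_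
  refine (hyp_form _).trans (Eq.trans ?_ (binary_form α x).symm)
  simp only [hα, Matrix.cons_val_zero, Matrix.cons_val_one]
  linear_combination (t * x 0 * x 1) * h2

theorem binary_sum_self_hyperbolic [CharP F 2] (α : F) :
    ((binary α).sum (binary α)).Hyperbolic := by
  refine Hyperbolic.congr ?_ (hyp_hyperbolic.sum hyp_hyperbolic)
  refine (sum_equivalent_prod _ _).trans (QuadraticMap.Equivalent.trans ?_
    (sum_equivalent_prod _ _).symm)
  have h2 := CharTwo.two_eq_zero (R := F)
  have hf : IsLinearMap F fun x : (Fin 2 → F) × (Fin 2 → F) =>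
      ((![x.1 0 + x.2 0, x.1 0 + x.2 0 + x.1 1],
        ![x.1 1 + x.2 1, α * (x.1 1 + x.2 1) + x.2 0]) : (Fin 2 → F) × (Fin 2 → F)) := by
    constructor
    · intro x y
      ext i <;> fin_cases i <;> simp <;> ring
    · intro c x
      ext i <;> fin_cases i <;> simp <;> ring
  refine equivalent_of_inverse (V := (Fin 2 → F) × (Fin 2 → F)) (W := (Fin 2 → F) × (Fin 2 → F))
    (fun x => (![x.1 0 + x.2 0, x.1 0 + x.2 0 + x.1 1],
      ![x.1 1 + x.2 1, α * (x.1 1 + x.2 1) + x.2 0]))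
    (fun x => (![x.1 0 + x.2 1 + α * x.2 0, x.1 0 + x.1 1],
      ![x.2 1 + α * x.2 0, x.1 0 + x.1 1 + x.2 0]))
    hf.map_add hf.map_smul (fun x => ?_) (fun x => ?_) (fun x => ?_)
  · refine Prod.ext (funext (Fin.forall_fin_two.2 ⟨?_, ?_⟩))
      (funext (Fin.forall_fin_two.2 ⟨?_, ?_⟩)) <;>
      simp only [Matrix.cons_val_zero, Matrix.cons_val_one]
    · linear_combination (x.2 0 + α * (x.1 1 + x.2 1)) * h2
    · linear_combination (x.1 0 + x.2 0) * h2
    · linear_combination (α * (x.1 1 + x.2 1)) * h2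
    · linear_combination (x.1 0 + x.2 0 + x.1 1) * h2
  · refine Prod.ext (funext (Fin.forall_fin_two.2 ⟨?_, ?_⟩))
      (funext (Fin.forall_fin_two.2 ⟨?_, ?_⟩)) <;>
      simp only [Matrix.cons_val_zero, Matrix.cons_val_one]
    · linear_combination (x.2 1 + α * x.2 0) * h2
    · linear_combination (x.1 0 + x.2 1 + α * x.2 0) * h2
    · linear_combination (x.1 0 + x.1 1) * h2
    · linear_combination (α * (x.1 0 + x.1 1 + x.2 0)) * h2
  · refine (congrArg₂ (· + ·) (hyp_form ![x.1 0 + x.2 0, x.1 0 + x.2 0 + x.1 1])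
      (hyp_form ![x.1 1 + x.2 1, α * (x.1 1 + x.2 1) + x.2 0])).trans
      (Eq.trans ?_ (congrArg₂ (· + ·) (binary_form α x.1) (binary_form α x.2)).symm)
    simp only [Matrix.cons_val_zero, Matrix.cons_val_one]
    linear_combination (x.1 0 * x.2 0 + x.1 1 * x.2 0 + α * x.1 1 * x.2 1) * h2

theorem twist_one [CharP F 2] (q : QF F) : q.twist 1 = q.sum q := by
  rw [twist, CharTwo.neg_eq, one_smul_eq]

theorem btensor_binary_sum_self_hyperbolic [CharP F 2] (α : F) {l : List F} (hl : UnitList l) :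
    ((btensor l (binary α)).sum (btensor l (binary α))).Hyperbolic := by
  rw [← twist_one]
  refine Hyperbolic.congr (btensor_twist_comm l 1 _).symm (Hyperbolic.btensor ?_ hl)
  rw [twist_one]
  exact binary_sum_self_hyperbolic α

/-- An isotropic quadratic Pfister form in characteristic two is hyperbolic. -/
theorem btensor_binary_hyperbolic_of_isotropic [CharP F 2] (α : F) {l : List F}
    (hl : UnitList l) (h : (btensor l (binary α)).Isotropic) :
    (btensor l (binary α)).Hyperbolic := by
  induction l with
  | nil => exact binary_hyperbolic_of_isotropic h
  | cons γ l ih =>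
    have hl' : UnitList l := fun x hx => hl x (List.mem_cons_of_mem _ hx)
    have hγ : γ ≠ 0 := hl γ List.mem_cons_self
    have hround : (btensor l (binary α)).Round := (binary_round α).btensor hl'
    have hdouble := btensor_binary_sum_self_hyperbolic α hl'
    change (twist γ (btensor l (binary α))).Isotropic at h
    change (twist γ (btensor l (binary α))).Hyperbolic
    specialize ih hl'
    generalize btensor l (binary α) = q at *
    by_cases hq : q.Isotropic
    · exact (ih hq).twist hγ
    obtain ⟨v, hv, hv0⟩ := h
    obtain ⟨⟨x, y⟩, rfl⟩ := (finSplit F q.dim q.dim).symm.surjective v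
    have hval : q.form x + -γ * q.form y = 0 :=
      (sum_form_symm q ((-γ) • q) x y).symm.trans hv
    have hy : q.form y ≠ 0 := by
      intro hy
      rw [hy, mul_zero, add_zero] at hval
      have hx0 : x = 0 := by_contra fun hx0 => hq ⟨x, hval, hx0⟩
      have hy0 : y = 0 := by_contra fun hy0 => hq ⟨y, hy, hy0⟩
      apply hv0
      rw [hx0, hy0]
      exact map_zero (finSplit F q.dim q.dim).symm
    have hx : q.form x ≠ 0 := by
      rw [add_eq_zero_iff_eq_neg] at hval
      rw [hval]
      simp [hγ, hy]
    refine Hyperbolic.congr (Equiv.sum (Equiv.refl q) ?_) hdouble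
    have hxy : q.form x = -γ * q.form y := by
      rw [CharTwo.neg_eq] at hval ⊢
      exact CharTwo.add_eq_zero.1 hval
    refine Equiv.trans ?_ (hround x hx)
    rw [hxy, ← smul_smul_eq]
    exact (hround y hy).symm.smul _

/-- `q.Embeds r`: the form `q` is isometric to a subform of `r`. -/
def Embeds (q r : QF F) : Prop :=
  ∃ f : (Fin q.dim → F) →ₗ[F] (Fin r.dim → F), Function.Injective f ∧
    ∀ v, r.form (f v) = q.form v

theorem Equiv.embeds {q r : QF F} (h : q.Equiv r) : q.Embeds r := by
  obtain ⟨e⟩ := h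
  exact ⟨e.toLinearEquiv.toLinearMap, e.toLinearEquiv.injective, e.map_app⟩

theorem Embeds.trans {q r s : QF F} (h : q.Embeds r) (h' : r.Embeds s) : q.Embeds s := by
  obtain ⟨f, hf, hf'⟩ := h
  obtain ⟨g, hg, hg'⟩ := h'
  exact ⟨g ∘ₗ f, hg.comp hf, fun v => (hg' _).trans (hf' v)⟩

theorem Embeds.smul {q r : QF F} (h : q.Embeds r) (a : F) : (a • q).Embeds (a • r) := by
  obtain ⟨f, hf, hf'⟩ := h
  exact ⟨f, hf, fun v => congrArg (a * ·) (hf' v)⟩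

theorem Embeds.sum {q q' r r' : QF F} (h : q.Embeds q') (h' : r.Embeds r') :
    (q.sum r).Embeds (q'.sum r') := by
  obtain ⟨f, hf, hf'⟩ := h
  obtain ⟨g, hg, hg'⟩ := h'
  refine ⟨(finSplit F _ _).symm.toLinearMap ∘ₗ f.prodMap g ∘ₗ (finSplit F _ _).toLinearMap,
    (finSplit F _ _).symm.injective.comp
      ((hf.prodMap hg).comp (finSplit F _ _).injective), fun v => ?_⟩
  exact (sum_form_symm q' r' _ _).trans (congrArg₂ (· + ·) (hf' _) (hg' _))

theorem Embeds.btensor {q r : QF F} (h : q.Embeds r) (l : List F) :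
    (q.btensor l).Embeds (r.btensor l) := by
  induction l with
  | nil => exact h
  | cons γ l ih => exact ih.sum (ih.smul _)

theorem Embeds.bpure {q r : QF F} (h : q.Embeds r) (l : List F) :
    (q.bpure l).Embeds (r.bpure l) := by
  induction l with
  | nil => exact (Equiv.refl _).embeds
  | cons γ l ih => exact ih.sum ((h.btensor l).smul _)

theorem btensor_equiv_sum_bpure (l : List F) (q : QF F) :
    (btensor l q).Equiv (q.sum (bpure l q)) := by
  induction l with
  | nil => exact (zero_sum_equiv q).symm.trans (sum_comm _ _)
  | cons γ l ih => exact (ih.sum (Equiv.refl _)).trans (sum_assoc _ _ _)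

theorem Embeds.isotropic {q r : QF F} (h : q.Embeds r) (hq : q.Isotropic) : r.Isotropic := by
  obtain ⟨f, hf, hf'⟩ := h
  obtain ⟨v, hv, hv0⟩ := hq
  exact ⟨f v, (hf' v).trans hv, (map_ne_zero_iff f hf).2 hv0⟩

theorem embeds_sum_left (q r : QF F) : q.Embeds (q.sum r) := by
  refine ⟨(finSplit F _ _).symm.toLinearMap ∘ₗ LinearMap.inl F _ _,
    (finSplit F _ _).symm.injective.comp LinearMap.inl_injective, fun v => ?_⟩
  exact (sum_form_symm q r v 0).trans (by rw [QuadraticMap.map_zero, add_zero])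

theorem embeds_btensor (l : List F) (q : QF F) : q.Embeds (btensor l q) :=
  (embeds_sum_left _ _).trans (btensor_equiv_sum_bpure l q).symm.embeds

theorem unit_form (x : Fin 1 → F) : (unit F).form x = x 0 * x 0 := rfl

theorem unit_embeds_binary (α : F) : (unit F).Embeds (binary α) := by
  refine ⟨(LinearMap.single F (fun _ : Fin 2 => F) 0) ∘ₗ LinearMap.proj (0 : Fin 1),
    fun (x : Fin 1 → F) (y : Fin 1 → F) h => ?_, fun (v : Fin 1 → F) => ?_⟩
  · exact funext (Fin.forall_fin_one.2 (Pi.single_injective (M := fun _ : Fin 2 => F) 0 h))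
  · refine (binary_form α (Pi.single (0 : Fin 2) (v 0))).trans (Eq.trans ?_ (unit_form v).symm)
    simp

/-- A quadratic form is nondegenerate if its polar form has trivial radical. -/
def Nondegenerate (q : QF F) : Prop := ∀ x, (∀ y, polar q.form x y = 0) → x = 0

theorem Nondegenerate.congr {q r : QF F} (h : q.Equiv r) (hq : q.Nondegenerate) :
    r.Nondegenerate := by
  obtain ⟨e⟩ := h.symm
  intro x hx
  refine (map_eq_zero_iff e.toLinearEquiv e.toLinearEquiv.injective).1 (hq _ fun y => ?_)
  obtain ⟨z, rfl⟩ := e.toLinearEquiv.surjective y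
  rw [← hx z]
  unfold polar
  rw [← map_add]
  exact congrArg₂ (· - ·) (congrArg₂ (· - ·) (e.map_app _) (e.map_app _)) (e.map_app _)

theorem Nondegenerate.smul {q : QF F} (hq : q.Nondegenerate) {a : F} (ha : a ≠ 0) :
    (a • q).Nondegenerate := by
  intro x hx
  refine hq x fun y => (mul_eq_zero.1 ?_).resolve_left ha
  rw [← hx y]
  exact (QuadraticMap.polar_smul q.form a x y).symm

theorem Nondegenerate.sum {q r : QF F} (hq : q.Nondegenerate) (hr : r.Nondegenerate) :
    (q.sum r).Nondegenerate := by
  intro x hx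
  obtain ⟨⟨a, b⟩, rfl⟩ := (finSplit F q.dim r.dim).symm.surjective x
  have key : ∀ c d, polar q.form a c + polar r.form b d = 0 := by
    intro c d
    have h := sum_form_symm q r
    have hadd : (finSplit F q.dim r.dim).symm (a, b) + (finSplit F q.dim r.dim).symm (c, d) =
        (finSplit F q.dim r.dim).symm (a + c, b + d) :=
      (map_add (finSplit F q.dim r.dim).symm _ _).symm
    have e : polar (q.sum r).form ((finSplit F q.dim r.dim).symm (a, b))
        ((finSplit F q.dim r.dim).symm (c, d)) = (q.form (a + c) + r.form (b + d)) -
          (q.form a + r.form b) - (q.form c + r.form d) :=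
      congrArg₂ (· - ·) (congrArg₂ (· - ·) ((congrArg (q.sum r).form hadd).trans (h _ _)) (h _ _))
        (h _ _)
    have h0 := e.symm.trans (hx _)
    unfold polar
    linear_combination h0
  have ha : a = 0 := hq a fun c => by simpa using key c 0
  have hb : b = 0 := hr b fun d => by simpa using key 0 d
  rw [ha, hb]
  exact map_zero (finSplit F q.dim r.dim).symm

theorem Nondegenerate.btensor {q : QF F} (hq : q.Nondegenerate) {l : List F} (hl : UnitList l) :
    (q.btensor l).Nondegenerate := by
  induction l with
  | nil => exact hq
  | cons γ l ih =>
    have h := ih fun x hx => hl x (List.mem_cons_of_mem _ hx)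
    exact h.sum (h.smul (neg_ne_zero.2 (hl γ List.mem_cons_self)))

theorem binary_nondegenerate [CharP F 2] (α : F) : (binary α).Nondegenerate := by
  intro (x : Fin 2 → F) hx
  have h2 := CharTwo.two_eq_zero (R := F)
  have key : ∀ y : Fin 2 → F, x 0 * y 1 + x 1 * y 0 = 0 := by
    intro y
    have h : (binary α).form (x + y) - (binary α).form x - (binary α).form y = 0 := hx y
    rw [binary_form, binary_form] at h
    erw [binary_form] at h
    simp only [Pi.add_apply] at h
    linear_combination h - (x 0 * y 0 + α * x 1 * y 1) * h2
  refine funext (Fin.forall_fin_two.2 ⟨?_, ?_⟩)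
  · have h := key ![0, 1]
    simp at h
    exact h
  · have h := key ![1, 0]
    simp at h
    exact h

/-- A form is totally singular if it is additive, that is, its polar form vanishes. -/
def TotallySingular (q : QF F) : Prop := ∀ x y, q.form (x + y) = q.form x + q.form y

theorem TotallySingular.smul {q : QF F} (hq : q.TotallySingular) (a : F) :
    (a • q).TotallySingular := fun x y =>
  (congrArg (a * ·) (hq x y)).trans (mul_add _ _ _)

theorem TotallySingular.sum {q r : QF F} (hq : q.TotallySingular) (hr : r.TotallySingular) :
    (q.sum r).TotallySingular := fun _ _ =>
  (congrArg₂ (· + ·) (hq _ _) (hr _ _)).trans (add_add_add_comm _ _ _ _)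

theorem TotallySingular.btensor {q : QF F} (hq : q.TotallySingular) (l : List F) :
    (q.btensor l).TotallySingular := by
  induction l with
  | nil => exact hq
  | cons γ l ih => exact ih.sum (ih.smul _)

theorem unit_totallySingular [CharP F 2] : (unit F).TotallySingular := fun _ _ =>
  CharTwo.add_mul_self _ _

theorem btensor_dim (l : List F) (q : QF F) : (btensor l q).dim = 2 ^ l.length * q.dim := by
  induction l with
  | nil => simp [btensor]
  | cons γ l ih =>
    change (btensor l q).dim + (btensor l q).dim = _
    rw [ih, List.length_cons]
    ring

theorem Equiv.dim_eq {q r : QF F} (h : q.Equiv r) : q.dim = r.dim := by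
  obtain ⟨e⟩ := h
  simpa using e.toLinearEquiv.finrank_eq

/-- If an additive quadratic form `β` maps isometrically into both `π ⊥ Q₁` and `π ⊥ Q₂`, where
`π` is nondegenerate of the same dimension as `β`, then `Q₁ ⊥ Q₂` is isotropic or represents
every value of `β`. -/
theorem represents_or_isotropic_of_isometries [CharP F 2] {B P X Y : Type*}
    [AddCommGroup B] [Module F B] [FiniteDimensional F B]
    [AddCommGroup P] [Module F P] [FiniteDimensional F P]
    [AddCommGroup X] [Module F X] [AddCommGroup Y] [Module F Y]
    {β : B → F} {π : QuadraticForm F P} {Q₁ : QuadraticForm F X} {Q₂ : QuadraticForm F Y}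
    (hβ : ∀ u v, β (u + v) = β u + β v)
    (hπ : ∀ x, (∀ y, polar π x y = 0) → x = 0)
    (hdim : Module.finrank F B = Module.finrank F P)
    (p₁ p₂ : B →ₗ[F] P) (x₁ : B →ₗ[F] X) (x₂ : B →ₗ[F] Y)
    (h₁ : ∀ w, π (p₁ w) + Q₁ (x₁ w) = β w) (h₂ : ∀ w, π (p₂ w) + Q₂ (x₂ w) = β w)
    (hinj : ∀ w, p₁ w = 0 → x₁ w = 0 → w = 0) (e : B) :
    ∃ x y, Q₁ x + Q₂ y = β e ∨ (Q₁ x + Q₂ y = 0 ∧ (x, y) ≠ 0) := by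
  by_contra! hcon
  have haniso : ∀ x y, Q₁ x + Q₂ y = 0 → x = 0 ∧ y = 0 := fun x y h =>
    Prod.mk_eq_zero.1 ((hcon x y).2 h)
  have hpol₁ : ∀ u v, polar π (p₁ u) (p₁ v) + polar Q₁ (x₁ u) (x₁ v) = 0 := by
    intro u v
    have h := h₁ (u + v)
    rw [map_add p₁, map_add x₁, hβ, ← h₁, ← h₁] at h
    unfold polar
    linear_combination h
  have hpol₂ : ∀ u v, polar π (p₂ u) (p₂ v) + polar Q₂ (x₂ u) (x₂ v) = 0 := by
    intro u v
    have h := h₂ (u + v)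
    rw [map_add p₂, map_add x₂, hβ, ← h₂, ← h₂] at h
    unfold polar
    linear_combination h
  have hneg : ∀ a : P, -a = a := fun a => by
    rw [← neg_one_smul F a, CharTwo.neg_eq, one_smul]
  have hker : ∀ w ∈ LinearMap.ker (p₁ + p₂), p₂ w = p₁ w ∧ x₁ w = 0 ∧ x₂ w = 0 := by
    intro w hw
    have hp : p₂ w = p₁ w := by
      rw [← hneg (p₁ w)]
      exact (neg_eq_of_add_eq_zero_right hw).symm
    refine ⟨hp, haniso _ _ ?_⟩
    have h := h₂ w
    rw [hp, ← h₁ w] at h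
    rw [add_left_cancel h, CharTwo.add_self_eq_zero]
  set W := LinearMap.ker (p₁ + p₂) with hW
  have hfin : Module.finrank F (W.map p₁) = Module.finrank F W := by
    rw [← LinearMap.range_domRestrict]
    refine LinearMap.finrank_range_of_inj ((injective_iff_map_eq_zero _).2 fun w hw => ?_)
    exact Subtype.ext (hinj w hw (hker w w.2).2.1)
  have hnd : (π.polarBilin : LinearMap.BilinForm F P).Nondegenerate := by
    have hrefl : LinearMap.IsRefl (π.polarBilin : LinearMap.BilinForm F P) := fun a b h =>
      (QuadraticMap.polar_comm π b a).trans h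
    exact hrefl.nondegenerate_iff_separatingLeft.2 hπ
  have hrange : LinearMap.range (p₁ + p₂) =
      LinearMap.BilinForm.orthogonal π.polarBilin (W.map p₁) := by
    refine Submodule.eq_of_le_of_finrank_eq ?_ ?_
    · rintro _ ⟨u, rfl⟩ _ ⟨w, hw, rfl⟩
      obtain ⟨hp, hx, hy⟩ := hker w hw
      have e₁ := hpol₁ w u
      have e₂ := hpol₂ w u
      rw [hx, QuadraticMap.polar_zero_left, add_zero] at e₁
      rw [hy, QuadraticMap.polar_zero_left, add_zero, hp] at e₂
      change polar π (p₁ w) (p₁ u + p₂ u) = 0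
      rw [QuadraticMap.polar_add_right, e₁, e₂, add_zero]
    · have := LinearMap.finrank_range_add_finrank_ker (p₁ + p₂)
      rw [← hW] at this
      rw [LinearMap.BilinForm.finrank_orthogonal hnd, hfin]
      omega
  obtain ⟨w, hw⟩ : p₂ e ∈ LinearMap.range (p₁ + p₂) := by
    rw [hrange]
    rintro _ ⟨w, hw, rfl⟩
    obtain ⟨hp, hx, hy⟩ := hker w hw
    have e₂ := hpol₂ w e
    rw [hy, QuadraticMap.polar_zero_left, add_zero, hp] at e₂
    exact e₂
  refine (hcon (x₁ w) (x₂ (w + e))).1 ?_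
  have hp : p₂ (w + e) = p₁ w := by
    rw [map_add, ← hw, LinearMap.add_apply, add_left_comm,
      eq_neg_iff_add_eq_zero.1 (hneg (p₂ w)).symm, add_zero]
  have e₁ := h₁ w
  have e₂ := h₂ (w + e)
  rw [hp, hβ] at e₂
  linear_combination e₁ + e₂ + (β w - π (p₁ w)) * CharTwo.two_eq_zero (R := F)

theorem isotropic_sum_sum [CharP F 2] {b π Q₁ Q₂ : QF F} (hb : b.TotallySingular)
    (hπ : π.Nondegenerate) (hdim : b.dim = π.dim) (h₁ : b.Embeds (π.sum Q₁))
    (h₂ : b.Embeds (π.sum Q₂)) (hb1 : (unit F).Embeds b) (hπ1 : (unit F).Embeds π) :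
    ((π.sum Q₂).sum Q₁).Isotropic := by
  obtain ⟨f, hf, hf'⟩ := h₁
  obtain ⟨g, -, hg'⟩ := h₂
  obtain ⟨i, -, hi⟩ := hb1
  obtain ⟨j, hj, hj'⟩ := hπ1
  obtain ⟨u, hone⟩ : ∃ u, (unit F).form u = 1 := ⟨fun _ : Fin 1 => 1, mul_one 1⟩
  have hfinal : ∀ p x y, Q₁.form x + Q₂.form y + π.form p = 0 → (x, y, p) ≠ 0 →
      ((π.sum Q₂).sum Q₁).Isotropic := by
    intro p x y h hne
    refine ⟨(finSplit F (π.sum Q₂).dim Q₁.dim).symm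
      ((finSplit F π.dim Q₂.dim).symm (p, y), x), ?_, fun h0 => hne ?_⟩
    · refine (sum_form_symm _ _ _ _).trans ?_
      erw [sum_form_symm]
      rw [← h]
      ring
    · have h1 := Prod.mk_eq_zero.1 ((finSplit F (π.sum Q₂).dim Q₁.dim).symm.map_eq_zero_iff.1 h0)
      have h2 := Prod.mk_eq_zero.1 ((finSplit F π.dim Q₂.dim).symm.map_eq_zero_iff.1 h1.1)
      rw [h1.2, h2.1, h2.2]
      rfl
  obtain ⟨x, y, h | ⟨h, hne⟩⟩ := represents_or_isotropic_of_isometries (Q₁ := Q₁.form)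
    (Q₂ := Q₂.form) hb hπ (by simpa using hdim)
    (LinearMap.fst F _ _ ∘ₗ (finSplit F π.dim Q₁.dim).toLinearMap ∘ₗ f)
    (LinearMap.fst F _ _ ∘ₗ (finSplit F π.dim Q₂.dim).toLinearMap ∘ₗ g)
    (LinearMap.snd F _ _ ∘ₗ (finSplit F π.dim Q₁.dim).toLinearMap ∘ₗ f)
    (LinearMap.snd F _ _ ∘ₗ (finSplit F π.dim Q₂.dim).toLinearMap ∘ₗ g)
    hf' hg' (fun w h h' => hf (((finSplit F π.dim Q₁.dim).injective
      ((Prod.ext h h').trans (map_zero _).symm)).trans (map_zero f).symm))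
    (i u)
  · refine hfinal (j u) x y ?_ fun h0 => ?_
    · rw [h, hi, hj', hone]
      exact CharTwo.add_self_eq_zero 1
    · have h1 : (j u) = 0 := (Prod.mk_eq_zero.1 (Prod.mk_eq_zero.1 h0).2).2
      have h2 := hj' u
      rw [h1, hone, QuadraticMap.map_zero] at h2
      exact zero_ne_one h2
  · refine hfinal 0 x y ?_ fun h0 => hne ?_
    · rw [h, QuadraticMap.map_zero, add_zero]
    · simp only [Prod.mk_eq_zero] at h0 ⊢
      exact ⟨h0.1, h0.2.1⟩

theorem UnitList.append {l l' : List F} (h : UnitList l) (h' : UnitList l') :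
    UnitList (l ++ l') := fun x hx =>
  (List.mem_append.1 hx).elim (h x) (h' x)

theorem IsQPfister.exists_btensor_binary (hchar : ringChar F = 2) {n : ℕ} {q : QF F}
    (h : IsQPfister n q) : ∃ (l : List F) (α : F), UnitList l ∧ l.length + 1 = n ∧
      (btensor l (binary α)).Equiv q := by
  rwa [IsQPfister, if_pos hchar] at h

theorem IsPairInv.hyperbolic_of_common_factor (hchar : ringChar F = 2) {k : ℕ}
    {ψ₁ ψ₂ q : QF F} (hq : IsPairInv k ψ₁ ψ₂ q) {l : List F} (hlen : l.length = k)
    (h₁ : ∃ (n : ℕ) (ρ : QF F), IsQPfister n ρ ∧ (btensor l ρ).Equiv ψ₁)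
    (h₂ : ∃ (n : ℕ) (ρ : QF F), IsQPfister n ρ ∧ (btensor l ρ).Equiv ψ₂) :
    q.Hyperbolic := by
  have : CharP F 2 := ringChar.of_eq hchar
  obtain ⟨π, l₁, l₂, hπ, hl₁, hl₂, e₁, e₂, eq⟩ := hq
  obtain ⟨m, α, hm, hmk, eπ⟩ := hπ.exists_btensor_binary hchar
  have hemb {n ρ ψ l'} (hρ : IsQPfister n ρ) (e : (btensor l ρ).Equiv ψ)
      (e' : (btensor l' π).Equiv ψ) : (btensor l (unit F)).Embeds (π.sum (bpure l' π)) := by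
    obtain ⟨m', α', -, -, eρ⟩ := hρ.exists_btensor_binary hchar
    exact ((((unit_embeds_binary α').trans (embeds_btensor m' _)).trans eρ.embeds).btensor l).trans
      ((e.trans e'.symm).trans (btensor_equiv_sum_bpure l' π)).embeds
  obtain ⟨n₁, ρ₁, hρ₁, f₁⟩ := h₁
  obtain ⟨n₂, ρ₂, hρ₂, f₂⟩ := h₂
  have hdim : (btensor l (unit F)).dim = π.dim := by
    rw [← eπ.dim_eq, btensor_dim, btensor_dim, hlen, ← hmk, pow_succ]
    exact mul_one _
  have hiso := isotropic_sum_sum (unit_totallySingular.btensor l)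
    (((binary_nondegenerate α).btensor hm).congr eπ) hdim (hemb hρ₁ f₁ e₁) (hemb hρ₂ f₂ e₂)
    (embeds_btensor l _) (((unit_embeds_binary α).trans (embeds_btensor m _)).trans eπ.embeds)
  have hsub : ((π.sum (bpure l₂ π)).sum (bpure l₁ π)).Embeds (btensor l₁ (btensor l₂ π)) :=
    ((btensor_equiv_sum_bpure l₂ π).symm.embeds.sum ((embeds_btensor l₂ π).bpure l₁)).trans
      (btensor_equiv_sum_bpure l₁ _).symm.embeds
  have eall : (btensor l₁ (btensor l₂ π)).Equiv (btensor (l₁ ++ l₂ ++ m) (binary α)) := by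
    rw [btensor_append, btensor_append]
    exact (eπ.symm.btensor l₂).btensor l₁
  exact Hyperbolic.congr (eq.trans eall) (btensor_binary_hyperbolic_of_isotropic α
    ((hl₁.append hl₂).append hm) (eall.embeds.isotropic (hsub.isotropic hiso)))

theorem IsPairInv.hyperbolic_of_left {k : ℕ} {ψ₁ ψ₂ q : QF F} (hq : IsPairInv k ψ₁ ψ₂ q)
    (h : ψ₁.Hyperbolic) : q.Hyperbolic := by
  obtain ⟨π, l₁, l₂, -, -, hl₂, e₁, -, eq⟩ := hq
  exact Hyperbolic.congr (eq.trans (btensor_btensor_comm l₁ l₂ π))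
    ((Hyperbolic.congr e₁ h).btensor hl₂)

theorem IsInv.ne_nil {k : ℕ} {ψs : List (QF F)} {q : QF F} (h : IsInv k ψs q) : ψs ≠ [] := by
  cases h <;> simp

theorem IsInv.eq_of_length_eq_one {k : ℕ} {ψs : List (QF F)} {q : QF F} (h : IsInv k ψs q)
    (hlen : ψs.length = 1) : q ∈ ψs := by
  cases h with
  | single => simp
  | step h _ => exact absurd (by simpa using hlen) h.ne_nil

end QF
/-- Let `F` be a field of characteristic 2 and `ψ₁,…,ψ_t` quadratic
Pfister forms that are separably `k`-linked.  If they are also inseparably `k`-linked,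
then their `k`-invariant `F_k(ψ₁,…,ψ_t)` is hyperbolic. -/
theorem insep_linked_implies_multi_invariant_hyperbolic
    (F : Type) [Field F] (hchar : ringChar F = 2) (k : ℕ)
    (ψs : List (QF F)) (hlen : 2 ≤ ψs.length)
    (hsep : QF.SepLinked k ψs)
    (hinsep : QF.InsepLinked k ψs) :
    ∀ q, QF.IsInv k ψs q → q.Hyperbolic := by
  obtain ⟨l, -, hl, hψ⟩ := hinsep
  intro q hq
  clear hsep
  induction hq with
  | single ψ => simp at hlen
  | @step ψs ψ q' q hq' hpair ih =>
    rcases Nat.lt_or_ge ψs.length 2 with hlt | hge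
    · have h1 : ψs.length = 1 := by simp at hlen; omega
      exact hpair.hyperbolic_of_common_factor hchar hl
        (hψ _ (List.mem_append_left _ (hq'.eq_of_length_eq_one h1))) (hψ ψ (by simp))
    · exact hpair.hyperbolic_of_left (ih hge fun φ hφ => hψ φ (List.mem_append_left _ hφ))
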